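/- Let m be a positive integer, κ ≥ 0, λ ≥ 0, R > 0. Let f : ℝ^m → ℝ be twice continuously differentiable and let g : ℝ^m → ℝ be continuously differentiable such that x ↦ g(x) − (κ/2)‖x‖₂² is concave; set h := f − g and φ(x) := h(x) + λ‖x‖₁. Suppose x* ∈ ℝ^m with ‖x*‖₁ ≤ R, and there exist v*, w* ∈ ∂‖x*‖₁ and μ* ≥ 0 such that: (a) μ*(R − ‖x*‖₁) = 0; (b) ∇h(x*) + λv* + μ*w* = 0; and (c) sᵀ(∇²f(x*))s > κ for every s ∈ G*, where G* is the set of s ∈ ℝ^m with ‖s‖₂ = 1 such that: sup_{w ∈ ∂‖x*‖₁} sᵀw ≤ 0 whenever ‖x*‖₁ = R; sup_{v ∈ ∂‖x*‖₁} sᵀ(∇h(x*) + λv) = 0; and μ*·sup_{w ∈ ∂‖x*‖₁} sᵀw = 0. Then x* is an isolated local minimum of the program min_{‖x‖₁ ≤ R} φ(x): there exists ε > 0 such that φ(x) > φ(x*) for every x ≠ x* with ‖x − x*‖₂ < ε and ‖x‖₁ ≤ R. -/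

import Mathlib

open scoped BigOperators RealInnerProductSpace

/-- The ℓ₁-norm on `ℝ^m`. -/
noncomputable def norm1 {m : ℕ} (x : EuclideanSpace ℝ (Fin m)) : ℝ := ∑ j, |x j|

/-- The subdifferential of the ℓ₁-norm at `x`: vectors `v` with `‖v‖_∞ ≤ 1` and
`⟨v, x⟩ = ‖x‖₁`. -/
def l1Subdiff {m : Type*} [Fintype m] (x : m → ℝ) : Set (m → ℝ) :=
  {v | (∀ j, |v j| ≤ 1) ∧ ∑ j, v j * x j = ∑ j, |x j|}

/-- The directional derivative of the ℓ₁-norm at `x` in the direction `s`. -/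
noncomputable def l1DirDeriv {ι : Type*} [Fintype ι] (x s : ι → ℝ) : ℝ :=
  ∑ j, if x j = 0 then |s j| else (SignType.sign (x j) : ℝ) * s j

section L1

variable {ι : Type*} [Fintype ι]

theorem continuous_l1DirDeriv (x : ι → ℝ) : Continuous (l1DirDeriv x) := by
  unfold l1DirDeriv
  refine continuous_finsetSum _ fun j _ => ?_
  split_ifs <;> fun_prop

theorem l1DirDeriv_smul {t : ℝ} (ht : 0 ≤ t) (x s : ι → ℝ) :
    l1DirDeriv x (t • s) = t * l1DirDeriv x s := by
  unfold l1DirDeriv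
  rw [Finset.mul_sum]
  refine Finset.sum_congr rfl fun j _ => ?_
  split_ifs
  · simp [abs_mul, abs_of_nonneg ht]
  · simp only [Pi.smul_apply, smul_eq_mul]
    ring

theorem mul_eq_abs_of_mem_l1Subdiff {x v : ι → ℝ} (hv : v ∈ l1Subdiff x) (j : ι) :
    v j * x j = |x j| := by
  have hle : ∀ i ∈ Finset.univ, v i * x i ≤ |x i| := fun i _ => by
    refine (le_abs_self _).trans ?_
    rw [abs_mul]
    exact mul_le_of_le_one_left (abs_nonneg _) (hv.1 i)
  exact (Finset.sum_eq_sum_iff_of_le hle).1 hv.2 j (Finset.mem_univ j)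

theorem sum_mul_le_l1DirDeriv {x v : ι → ℝ} (hv : v ∈ l1Subdiff x) (s : ι → ℝ) :
    ∑ j, s j * v j ≤ l1DirDeriv x s := by
  refine Finset.sum_le_sum fun j _ => ?_
  split_ifs with h
  · refine (le_abs_self _).trans ?_
    rw [abs_mul]
    exact mul_le_of_le_one_right (abs_nonneg _) (hv.1 j)
  · have h1 : v j = (SignType.sign (x j) : ℝ) := by
      apply mul_right_cancel₀ h
      rw [mul_eq_abs_of_mem_l1Subdiff hv j, sign_mul_self]
    rw [h1, mul_comm]

theorem exists_mem_l1Subdiff_sum_eq (x s : ι → ℝ) :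
    ∃ v ∈ l1Subdiff x, ∑ j, s j * v j = l1DirDeriv x s := by
  have hsign : ∀ a : ℝ, |(SignType.sign a : ℝ)| ≤ 1 := fun a => by
    rcases lt_trichotomy a 0 with h | h | h <;> simp [h]
  refine ⟨fun j => if x j = 0 then (SignType.sign (s j) : ℝ) else (SignType.sign (x j) : ℝ),
    ⟨fun j => ?_, Finset.sum_congr rfl fun j _ => ?_⟩, Finset.sum_congr rfl fun j _ => ?_⟩
  · dsimp only
    split_ifs <;> exact hsign _
  · dsimp only
    split_ifs with h
    · simp [h]
    · exact sign_mul_self _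
  · dsimp only
    split_ifs
    · exact self_mul_sign _
    · exact mul_comm _ _

theorem sSup_l1Subdiff (x s : ι → ℝ) :
    sSup {r : ℝ | ∃ w ∈ l1Subdiff x, r = ∑ j, s j * w j} = l1DirDeriv x s := by
  refine IsGreatest.csSup_eq ⟨?_, ?_⟩
  · obtain ⟨v, hv, h⟩ := exists_mem_l1Subdiff_sum_eq x s
    exact ⟨v, hv, h.symm⟩
  · rintro r ⟨w, hw, rfl⟩
    exact sum_mul_le_l1DirDeriv hw s

theorem sSup_l1Subdiff_affine {lam : ℝ} (hlam : 0 ≤ lam) (x s c : ι → ℝ) :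
    sSup {r : ℝ | ∃ v ∈ l1Subdiff x, r = ∑ j, s j * (c j + lam * v j)} =
      ∑ j, s j * c j + lam * l1DirDeriv x s := by
  have hsplit : ∀ v : ι → ℝ, ∑ j, s j * (c j + lam * v j) =
      ∑ j, s j * c j + lam * ∑ j, s j * v j := fun v => by
    rw [Finset.mul_sum, ← Finset.sum_add_distrib]
    exact Finset.sum_congr rfl fun j _ => by ring
  refine IsGreatest.csSup_eq ⟨?_, ?_⟩
  · obtain ⟨v, hv, h⟩ := exists_mem_l1Subdiff_sum_eq x s
    exact ⟨v, hv, by rw [hsplit, h]⟩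
  · rintro r ⟨w, hw, rfl⟩
    rw [hsplit]
    gcongr
    exact sum_mul_le_l1DirDeriv hw s

theorem sum_abs_add_l1DirDeriv_le (x d : ι → ℝ) :
    ∑ j, |x j| + l1DirDeriv x d ≤ ∑ j, |x j + d j| := by
  unfold l1DirDeriv
  rw [← Finset.sum_add_distrib]
  refine Finset.sum_le_sum fun j _ => ?_
  split_ifs with h
  · simp [h]
  · rcases lt_or_gt_of_ne h with h | h
    · rw [abs_of_neg h, sign_neg h, SignType.coe_neg_one]
      have := neg_abs_le (x j + d j)
      linarith
    · rw [abs_of_pos h, sign_pos h, SignType.coe_one]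
      have := le_abs_self (x j + d j)
      linarith

end L1

theorem ContDiff.exists_abs_taylor_two_le {E : Type*} [NormedAddCommGroup E] [NormedSpace ℝ E]
    {f : E → ℝ} (hf : ContDiff ℝ 2 f) (a : E) {ε : ℝ} (hε : 0 < ε) :
    ∃ δ > 0, ∀ d : E, ‖d‖ < δ →
      |f (a + d) - f a - fderiv ℝ f a d - 1 / 2 * fderiv ℝ (fderiv ℝ f) a d d| ≤ ε * ‖d‖ ^ 2 := by
  set L := fderiv ℝ (fderiv ℝ f) a with hL
  have hsymm : ∀ u v, L u v = L v u := fun u v =>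
    (hf.contDiffAt.isSymmSndFDerivAt (by simp)) u v
  have hdf : HasFDerivAt (fderiv ℝ f) L a :=
    ((hf.fderiv_right (m := 1) (by norm_num)).differentiable (by norm_num) a).hasFDerivAt
  rw [hasFDerivAt_iff_isLittleO_nhds_zero] at hdf
  obtain ⟨δ, hδ, hball⟩ := Metric.eventually_nhds_iff.1 (Asymptotics.isLittleO_iff.1 hdf hε)
  refine ⟨δ, hδ, fun d hd => ?_⟩
  have hderiv : ∀ u ∈ Metric.closedBall (0 : E) ‖d‖,
      HasFDerivWithinAt (fun u => f (a + u) - f a - fderiv ℝ f a u - 1 / 2 * L u u)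
        (fderiv ℝ f (a + u) - fderiv ℝ f a - L u) (Metric.closedBall (0 : E) ‖d‖) u := by
    intro u _
    have h1 : HasFDerivAt (fun u => f (a + u)) (fderiv ℝ f (a + u)) u :=
      (hasFDerivAt_comp_add_left a).2 (hf.differentiable (by norm_num) (a + u)).hasFDerivAt
    have h2 : HasFDerivAt (fun u => L u u) ((L u).comp (ContinuousLinearMap.id ℝ E) + L.flip u) u :=
      L.hasFDerivAt.clm_apply (hasFDerivAt_id u)
    have h3 := ((h1.sub_const (f a)).sub (fderiv ℝ f a).hasFDerivAt).sub (h2.const_mul (1 / 2 : ℝ))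
    refine (h3.congr_fderiv ?_).hasFDerivWithinAt
    ext w
    simp [hsymm w u]
    ring
  have hbound : ∀ u ∈ Metric.closedBall (0 : E) ‖d‖,
      ‖fderiv ℝ f (a + u) - fderiv ℝ f a - L u‖ ≤ ε * ‖d‖ := by
    intro u hu
    rw [mem_closedBall_zero_iff] at hu
    refine (hball (by simpa using hu.trans_lt hd)).trans ?_
    gcongr
  have := (convex_closedBall (0 : E) ‖d‖).norm_image_sub_le_of_norm_hasFDerivWithin_le hderiv hbound
    (x := 0) (y := d) (by simp) (by simp)
  simpa [pow_two, mul_assoc] using this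

theorem ConcaveOn.le_add_fderiv {E : Type*} [NormedAddCommGroup E] [NormedSpace ℝ E]
    {f : E → ℝ} (hf : ConcaveOn ℝ Set.univ f) {a : E} {f' : E →L[ℝ] ℝ} (hf' : HasFDerivAt f f' a)
    (d : E) : f (a + d) ≤ f a + f' d := by
  have hconc : ConcaveOn ℝ Set.univ (f ∘ AffineMap.lineMap (k := ℝ) a (a + d)) := by
    simpa using hf.comp_affineMap (AffineMap.lineMap (k := ℝ) a (a + d))
  have hd : HasDerivAt (f ∘ AffineMap.lineMap (k := ℝ) a (a + d)) (f' d) 0 := by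
    have h := AffineMap.hasDerivAt_lineMap (𝕜 := ℝ) (a := a) (b := a + d) (x := 0)
    rw [add_sub_cancel_left] at h
    exact HasFDerivAt.comp_hasDerivAt _ (by simpa using hf') h
  have := hconc.slope_le_of_hasDerivAt (Set.mem_univ _) (Set.mem_univ _) zero_lt_one hd
  simp [slope_def_field] at this
  linarith

theorem ConcaveOn.le_add_fderiv_add_sq {E : Type*} [NormedAddCommGroup E] [InnerProductSpace ℝ E]
    {g : E → ℝ} {κ : ℝ} (hconc : ConcaveOn ℝ Set.univ fun x => g x - κ / 2 * ‖x‖ ^ 2) {a : E}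
    (hg : DifferentiableAt ℝ g a) (d : E) :
    g (a + d) ≤ g a + fderiv ℝ g a d + κ / 2 * ‖d‖ ^ 2 := by
  have h := hconc.le_add_fderiv
    (hg.hasFDerivAt.sub (((hasStrictFDerivAt_norm_sq a).hasFDerivAt).const_mul (κ / 2))) d
  simp [norm_add_sq_real] at h
  linarith

/-- On a compact set, a function that is positive where another one vanishes becomes uniformly
positive after adding a large multiple of the latter. -/
theorem IsCompact.exists_penalty {X : Type*} [TopologicalSpace X] {K : Set X} (hK : IsCompact K)
    {A B : X → ℝ} (hA : Continuous A) (hB : Continuous B) (hA0 : ∀ s ∈ K, 0 ≤ A s)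
    (hpos : ∀ s ∈ K, A s = 0 → 0 < B s) :
    ∃ M : ℕ, ∃ η > 0, ∀ s ∈ K, η ≤ M * A s + B s := by
  obtain ⟨M, hM⟩ := hK.elim_directed_cover (fun M : ℕ => {s | 0 < M * |A s| + B s})
    (fun M => isOpen_lt continuous_const (by fun_prop)) (fun s hs => by
      rw [Set.mem_iUnion]
      rcases (hA0 s hs).eq_or_lt with h | h
      · exact ⟨0, by simpa using hpos s hs h.symm⟩
      · obtain ⟨n, hn⟩ := exists_nat_gt (-B s / A s)
        rw [div_lt_iff₀ h] at hn
        refine ⟨n, ?_⟩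
        rw [Set.mem_ofPred_eq, abs_of_pos h]
        linarith)
    (Monotone.directed_le fun m n hmn s hs => by
      have h : (m : ℝ) * |A s| ≤ n * |A s| := by gcongr
      rw [Set.mem_ofPred_eq] at hs ⊢
      linarith)
  obtain ⟨η, hη, h⟩ := hK.exists_forall_le' (f := fun s => M * |A s| + B s) (a := 0)
    (by fun_prop) hM
  exact ⟨M, η, hη, fun s hs => by simpa [abs_of_nonneg (hA0 s hs)] using h s hs⟩

/-- sufficient conditions for isolated local minima of ℓ₁-constrained,
ℓ₁-penalized differences of functions: let `h = f − g` with `f ∈ C²`, `g ∈ C¹` and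
`g − (κ/2)‖·‖₂²` concave, and `φ = h + λ‖·‖₁`.  If `x*` is feasible, the KKT-type
conditions (a), (b) hold for some `v*, w* ∈ ∂‖x*‖₁`, `μ* ≥ 0`, and the Hessian of `f`
satisfies `sᵀ∇²f(x*)s > κ` on the critical cone `G*`, then `x*` is an isolated local
minimum of `min_{‖x‖₁ ≤ R} φ(x)`. -/
theorem isolated_local_min (m : ℕ) (hm : 0 < m) (κ lam R : ℝ)
    (hκ : 0 ≤ κ) (hlam : 0 ≤ lam) (hR : 0 < R)
    (f g : EuclideanSpace ℝ (Fin m) → ℝ) (hf : ContDiff ℝ 2 f) (hg : ContDiff ℝ 1 g)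
    (hgconc : ConcaveOn ℝ Set.univ (fun x => g x - κ / 2 * ‖x‖ ^ 2))
    (xstar : EuclideanSpace ℝ (Fin m)) (hfeas : norm1 xstar ≤ R)
    (vstar wstar : Fin m → ℝ) (mustar : ℝ) (hmustar : 0 ≤ mustar)
    (hv : vstar ∈ l1Subdiff (fun j => xstar j)) (hw : wstar ∈ l1Subdiff (fun j => xstar j))
    (hcompslack : mustar * (R - norm1 xstar) = 0)
    (hzerograd : ∀ j, gradient (fun x => f x - g x) xstar j +
      lam * vstar j + mustar * wstar j = 0)
    (hcurv : ∀ s : EuclideanSpace ℝ (Fin m), ‖s‖ = 1 →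
      (norm1 xstar = R →
        sSup {r : ℝ | ∃ w ∈ l1Subdiff (fun j => xstar j), r = ∑ j, s j * w j} ≤ 0) →
      sSup {r : ℝ | ∃ v ∈ l1Subdiff (fun j => xstar j),
        r = ∑ j, s j * (gradient (fun x => f x - g x) xstar j + lam * v j)} = 0 →
      mustar * sSup {r : ℝ | ∃ w ∈ l1Subdiff (fun j => xstar j), r = ∑ j, s j * w j} = 0 →
      κ < iteratedFDeriv ℝ 2 f xstar ![s, s]) :
    ∃ ε > 0, ∀ x : EuclideanSpace ℝ (Fin m), norm1 x ≤ R → ‖x - xstar‖ < ε → x ≠ xstar →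
      (f xstar - g xstar) + lam * norm1 xstar < (f x - g x) + lam * norm1 x := by
  set D : EuclideanSpace ℝ (Fin m) → ℝ := fun s => l1DirDeriv (fun j => xstar j) (fun j => s j)
    with hD
  set c : Fin m → ℝ := fun j => gradient (fun x => f x - g x) xstar j with hc
  have hfd : DifferentiableAt ℝ f xstar := hf.differentiable (by norm_num) xstar
  have hgd : DifferentiableAt ℝ g xstar := hg.differentiable (by norm_num) xstar
  have hcs : ∀ s : EuclideanSpace ℝ (Fin m),
      ∑ j, s j * c j = fderiv ℝ f xstar s - fderiv ℝ g xstar s := by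
    intro s
    have h : ⟪gradient (fun x => f x - g x) xstar, s⟫ = fderiv ℝ (fun x => f x - g x) xstar s := by
      simp [gradient]
    rw [fderiv_fun_sub hfd hgd] at h
    rw [← sub_apply, ← h, PiLp.inner_apply]
    simp [hc]
  set A : EuclideanSpace ℝ (Fin m) → ℝ := fun s => ∑ j, s j * c j + lam * D s with hAdef
  set B : EuclideanSpace ℝ (Fin m) → ℝ :=
    fun s => fderiv ℝ (fderiv ℝ f) xstar s s - κ with hBdef
  have hDcont : Continuous D := (continuous_l1DirDeriv _).comp (by fun_prop)
  have hDsmul : ∀ t : ℝ, 0 ≤ t → ∀ s, D (t • s) = t * D s := fun t ht s =>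
    l1DirDeriv_smul ht _ _
  have hAD : ∀ s, -(mustar * D s) ≤ A s := by
    intro s
    have h1 : D s ≥ ∑ j, s j * vstar j := sum_mul_le_l1DirDeriv hv _
    have h2 : D s ≥ ∑ j, s j * wstar j := sum_mul_le_l1DirDeriv hw _
    have h3 : ∑ j, s j * c j + lam * ∑ j, s j * vstar j + mustar * ∑ j, s j * wstar j = 0 := by
      rw [Finset.mul_sum, Finset.mul_sum, ← Finset.sum_add_distrib, ← Finset.sum_add_distrib]
      refine Finset.sum_eq_zero fun j _ => ?_
      linear_combination s j * hzerograd j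
    have h4 := mul_le_mul_of_nonneg_left h1 hlam
    have h5 := mul_le_mul_of_nonneg_left h2 hmustar
    simp only [hAdef]
    linarith
  set K : Set (EuclideanSpace ℝ (Fin m)) :=
    Metric.sphere 0 1 ∩ {s | norm1 xstar = R → D s ≤ 0} with hKdef
  have hK : IsCompact K := by
    refine (isCompact_sphere _ _).inter_right ?_
    by_cases h : norm1 xstar = R
    · simpa [h] using isClosed_le hDcont continuous_const
    · simp [h]
  have hmuD : ∀ s ∈ K, mustar * D s ≤ 0 := by
    rintro s ⟨-, hs⟩
    rcases mul_eq_zero.1 hcompslack with h | h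
    · simp [h]
    · exact mul_nonpos_of_nonneg_of_nonpos hmustar (hs (by linarith))
  have hA0 : ∀ s ∈ K, 0 ≤ A s := fun s hs => by linarith [hAD s, hmuD s hs]
  obtain ⟨M, η, hη, hMη⟩ := hK.exists_penalty (A := A) (B := B) (by fun_prop) (by fun_prop) hA0
    (fun s hs hAs => by
      have h := hcurv s (by simpa using hs.1)
        (fun h => (sSup_l1Subdiff _ _).trans_le (hs.2 h))
        ((sSup_l1Subdiff_affine hlam _ _ _).trans hAs) (by
          have h0 : mustar * D s = 0 := le_antisymm (hmuD s hs) (by linarith [hAD s])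
          rw [← h0]
          exact congrArg (mustar * ·) (sSup_l1Subdiff _ _))
      rw [iteratedFDeriv_two_apply] at h
      simpa [hBdef] using h)
  obtain ⟨δ, hδ, hT⟩ := hf.exists_abs_taylor_two_le xstar (ε := η / 4) (by positivity)
  refine ⟨min δ (2 / (M + 1)), by positivity, fun x hx hxε hne => ?_⟩
  obtain ⟨d, rfl⟩ : ∃ d, x = xstar + d := ⟨x - xstar, by abel⟩
  rw [add_sub_cancel_left] at hxε
  have hd : d ≠ 0 := by simpa using hne
  have hl1 : norm1 xstar + D d ≤ norm1 (xstar + d) :=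
    sum_abs_add_l1DirDeriv_le (fun j => xstar j) (fun j => d j)
  set t := ‖d‖ with ht
  have ht0 : 0 < t := norm_pos_iff.2 hd
  obtain ⟨s, hs1, hs⟩ : ∃ s : EuclideanSpace ℝ (Fin m), ‖s‖ = 1 ∧ d = t • s :=
    ⟨t⁻¹ • d, by rw [norm_smul, norm_inv, ht, norm_norm]; exact inv_mul_cancel₀ ht0.ne',
      (smul_inv_smul₀ ht0.ne' d).symm⟩
  have hDd : D d = t * D s := by rw [hs, hDsmul t ht0.le]
  have hsK : s ∈ K := by
    refine ⟨by simpa using hs1, fun h => ?_⟩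
    have : t * D s ≤ 0 := by linarith
    exact nonpos_of_mul_nonpos_right this ht0
  have hcd : fderiv ℝ f xstar d - fderiv ℝ g xstar d = t * ∑ j, s j * c j := by
    rw [hcs, hs]
    simp only [map_smul, smul_eq_mul]
    ring
  have hHd : fderiv ℝ (fderiv ℝ f) xstar d d = t ^ 2 * (B s + κ) := by
    rw [hs]
    simp [hBdef]
    ring
  have hTd := (abs_le.1 (hT d (hxε.trans_le (min_le_left _ _)))).1
  have hgle := hgconc.le_add_fderiv_add_sq hgd d
  rw [hHd] at hTd
  have htM : t * M ≤ 2 := by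
    have h := (hxε.trans_le (min_le_right _ _)).le
    rw [le_div_iff₀ (by positivity)] at h
    linarith
  have hAs := hA0 s hsK
  have h1 : t * (t * M) * A s ≤ t * 2 * A s := by gcongr
  have h2 : t ^ 2 * η ≤ t ^ 2 * (M * A s + B s) := by
    gcongr
    exact hMη s hsK
  have h3 : lam * (norm1 xstar + t * D s) ≤ lam * norm1 (xstar + d) := by
    gcongr
    rwa [← hDd]
  have h4 : t * A s = t * ∑ j, s j * c j + lam * (t * D s) := by
    simp only [hAdef]
    ring
  have h5 : 0 < t ^ 2 * η := by positivity
  linarith
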